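/- Fix a natural number n > e^4200. Then log p_n^(k) = k(log k + log log k + O(1)) as k → ∞; that is, there exists a constant C > 0 (which may depend on n) and K such that for all k ≥ K one has |log p_n^(k) − k(log k + log log k)| ≤ C·k. -/

import Mathlib

open Real Filter

/-- `nthPrime n` is the `n`-th prime number, 1-indexed: `nthPrime 1 = 2`, `nthPrime 2 = 3`, … -/
noncomputable def nthPrime (n : ℕ) : ℕ := Nat.nth Nat.Prime (n - 1)

/-- `iterPrime n k` is the `k`-fold iterated prime `p_n^(k)`:
`iterPrime n 0 = n`, `iterPrime n 1 = p_n`, and `iterPrime n (k+1) = p_{iterPrime n k}`. -/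
noncomputable def iterPrime (n : ℕ) : ℕ → ℕ
  | 0 => n
  | k + 1 => nthPrime (iterPrime n k)

theorem primeCounting_nthPrime {m : ℕ} (hm : 1 ≤ m) : Nat.primeCounting (nthPrime m) = m := by
  have h := Nat.count_nth_succ_of_infinite Nat.infinite_setOfPred_prime (m - 1)
  rw [Nat.sub_add_cancel hm] at h
  exact h

theorem lt_nthPrime (m : ℕ) : m < nthPrime m := by
  have := Nat.add_two_le_nth_prime (m - 1)
  unfold nthPrime
  omega

theorem tendsto_nthPrime : Tendsto nthPrime atTop atTop :=
  tendsto_atTop_mono (fun m => (lt_nthPrime m).le) tendsto_id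

theorem tendsto_iterPrime (n : ℕ) : Tendsto (iterPrime n) atTop atTop :=
  (strictMono_nat_of_lt_succ fun _ => lt_nthPrime _).tendsto_atTop

theorem log_le_log_add_div {x y : ℝ} (hx : 0 < x) (hy : 0 < y) :
    log y ≤ log x + (y - x) / x := by
  have h := log_le_sub_one_of_pos (div_pos hy hx)
  rw [log_div hy.ne' hx.ne'] at h
  have : (y - x) / x = y / x - 1 := by field_simp
  linarith

theorem eventually_log_le_mul {c : ℝ} (hc : 0 < c) : ∀ᶠ x : ℝ in atTop, log x ≤ c * x := by
  filter_upwards [isLittleO_log_id_atTop.bound hc, eventually_ge_atTop 0] with x h hx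
  rw [id, norm_of_nonneg hx] at h
  exact (le_abs_self _).trans h

/-- Chebyshev's bounds, in the form `log p_m = log m + log log m + O(1)`. -/
theorem exists_abs_log_nthPrime_sub_le :
    ∃ A : ℝ, 0 ≤ A ∧
      ∀ᶠ m : ℕ in atTop, |log (nthPrime m) - log m - log (log m)| ≤ A := by
  have hc : 0 ≤ log (log 4 + 1) := log_nonneg (by linarith [log_nonneg (x := 4) (by norm_num)])
  have hl2 : 0 < log 2 := log_pos one_lt_two
  refine ⟨log (log 4 + 1) + 2 * log 2, by positivity, ?_⟩
  have hx : Tendsto (fun m : ℕ => (nthPrime m : ℝ)) atTop atTop :=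
    tendsto_natCast_atTop_atTop.comp tendsto_nthPrime
  have hlogx := tendsto_log_atTop.comp hx
  filter_upwards [hx.eventually (Chebyshev.eventually_primeCounting_le one_pos),
    hx.eventually (eventually_log_le_mul (c := 1 / 20) (by norm_num)),
    hlogx.eventually (eventually_log_le_mul (c := 1 / 4) (by norm_num)),
    hlogx.eventually (eventually_ge_atTop 10), eventually_ge_atTop 3] with m h1 h2 h3 h4 hm
  simp only [Function.comp_apply] at h3 h4
  rw [Nat.floor_natCast, primeCounting_nthPrime (by omega)] at h1
  have h5 := Chebyshev.pi_ge (nthPrime m)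
  rw [primeCounting_nthPrime (by omega)] at h5
  have hmx : (m : ℝ) < nthPrime m := by exact_mod_cast lt_nthPrime m
  have hm3 : (3 : ℝ) ≤ m := by exact_mod_cast hm
  generalize (nthPrime m : ℝ) = x at *
  generalize (m : ℝ) = y at *
  have hx0 : 0 < x := by linarith
  have hy0 : 0 < y := by linarith
  have hly : 0 < log y := log_pos (by linarith)
  have hlx : 0 < log x := by linarith
  have hlxy : log y ≤ log x := log_le_log hy0 hmx.le
  have hllxy : log (log y) ≤ log (log x) := log_le_log hly hlxy
  have hl4 : 0 < log 4 + 1 := by linarith [log_nonneg (x := 4) (by norm_num)]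
  have lower : log y ≤ log (log 4 + 1) + log x - log (log x) := by
    have := log_le_log hy0 h1
    rwa [log_div (by positivity) hlx.ne', log_mul hl4.ne' hx0.ne'] at this
  have upper : log x - log 2 ≤ log y + log (log x) := by
    rw [div_le_iff₀ hlx] at h5
    have h6 : log (x + 1) ≤ log x + (x + 1 - x) / x := log_le_log_add_div hx0 (by linarith)
    have h7 : (x + 1 - x) / x ≤ 1 := by rw [div_le_one hx0]; linarith
    have h8 : x / 2 ≤ y * log x := by
      nlinarith [log_two_gt_d9]
    have := log_le_log (by positivity) h8
    rwa [log_div hx0.ne' two_ne_zero, log_mul hy0.ne' hlx.ne'] at this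
  have h9 : log x ≤ 2 * log y := by linarith [log_two_lt_d9]
  have h10 := log_le_log hlx h9
  rw [log_mul two_ne_zero hly.ne'] at h10
  rw [abs_le]
  constructor <;> linarith

theorem exists_eventually_le_add_of_succ_sub_le {u v : ℕ → ℝ}
    (h : ∀ᶠ k in atTop, u (k + 1) - u k ≤ v (k + 1) - v k) :
    ∃ C : ℝ, ∀ᶠ k in atTop, u k ≤ v k + C := by
  obtain ⟨K, hK⟩ := eventually_atTop.1 h
  refine ⟨u K - v K, eventually_atTop.2 ⟨K, fun k hk => ?_⟩⟩
  induction k, hk using Nat.le_induction with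
  | base => linarith
  | succ k hk ih => linarith [hK k hk]

theorem tendsto_log_natCast : Tendsto (fun k : ℕ => log k) atTop atTop :=
  tendsto_log_atTop.comp tendsto_natCast_atTop_atTop

theorem succ_mul_log_sub_le {x : ℝ} (hx : 1 ≤ x) :
    (x + 1) * log (x + 1) - x * log x ≤ log x + 2 := by
  have h : log (x + 1) ≤ log x + (x + 1 - x) / x := log_le_log_add_div (by linarith) (by linarith)
  have : (x + 1) * log (x + 1) ≤ (x + 1) * (log x + (x + 1 - x) / x) := by gcongr
  have h2 : (x + 1) * ((x + 1 - x) / x) ≤ 2 := by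
    rw [mul_div_assoc', div_le_iff₀ (by linarith)]; linarith
  linarith

theorem succ_mul_log_log_sub_le {x : ℝ} (hx : 1 ≤ x) (hl : 1 ≤ log x) :
    (x + 1) * log (log (x + 1)) - x * log (log x) ≤ log (log x) + 2 := by
  have h : log (x + 1) ≤ log x + (x + 1 - x) / x := log_le_log_add_div (by linarith) (by linarith)
  have h0 : log x ≤ log (x + 1) := log_le_log (by linarith) (by linarith)
  have h1 : log (log (x + 1)) ≤ log (log x) + (log (x + 1) - log x) / log x :=
    log_le_log_add_div (by linarith) (by linarith)
  have h2 : (log (x + 1) - log x) / log x ≤ (x + 1 - x) / x :=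
    (div_le_self (by linarith) hl).trans (by linarith)
  have : (x + 1) * log (log (x + 1)) ≤ (x + 1) * (log (log x) + (x + 1 - x) / x) := by
    gcongr
    linarith
  have h2 : (x + 1) * ((x + 1 - x) / x) ≤ 2 := by
    rw [mul_div_assoc', div_le_iff₀ (by linarith)]; linarith
  linarith

section Recurrence

variable {L : ℕ → ℝ} {A : ℝ}

theorem eventually_half_le (hL : Tendsto L atTop atTop)
    (h : ∀ᶠ k in atTop, log (L k) - A ≤ L (k + 1) - L k) :
    ∀ᶠ k : ℕ in atTop, (k : ℝ) / 2 ≤ L k := by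
  obtain ⟨C, hC⟩ := exists_eventually_le_add_of_succ_sub_le (u := fun k => (k : ℝ)) (v := L) (by
    filter_upwards [h, (tendsto_log_atTop.comp hL).eventually_ge_atTop (A + 1)] with k h1 h2
    simp only [Function.comp_apply] at h2
    push_cast
    linarith)
  filter_upwards [hC, tendsto_natCast_atTop_atTop.eventually_ge_atTop (2 * C)] with k h1 h2
  linarith

theorem eventually_half_mul_log_le (hL : Tendsto L atTop atTop)
    (h : ∀ᶠ k in atTop, log (L k) - A ≤ L (k + 1) - L k) :
    ∀ᶠ k : ℕ in atTop, (k : ℝ) * log k / 2 ≤ L k := by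
  obtain ⟨C, hC⟩ := exists_eventually_le_add_of_succ_sub_le
      (u := fun k => (k : ℝ) * log k - (A + log 2 + 2) * k) (v := L) (by
    filter_upwards [h, eventually_half_le hL h, eventually_ge_atTop 1] with k h1 h2 hk
    have hk1 : (1 : ℝ) ≤ k := by exact_mod_cast hk
    have h3 := succ_mul_log_sub_le hk1
    have h4 := log_le_log (by positivity) h2
    rw [log_div (by positivity) two_ne_zero] at h4
    push_cast
    linarith)
  filter_upwards [hC, tendsto_log_natCast.eventually_ge_atTop (2 * (A + log 2 + 2 + |C|)),
    eventually_ge_atTop 1] with k h1 h2 hk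
  have hk1 : (1 : ℝ) ≤ k := by exact_mod_cast hk
  have h3 : (k : ℝ) * (2 * (A + log 2 + 2 + |C|)) ≤ k * log k := by gcongr
  nlinarith [le_abs_self C, abs_nonneg C]

theorem exists_eventually_mul_log_add_log_log_sub_le (hL : Tendsto L atTop atTop)
    (h : ∀ᶠ k in atTop, log (L k) - A ≤ L (k + 1) - L k) :
    ∃ C : ℝ, ∀ᶠ k : ℕ in atTop, (k : ℝ) * (log k + log (log k)) - C * k ≤ L k := by
  obtain ⟨C, hC⟩ := exists_eventually_le_add_of_succ_sub_le
      (u := fun k => (k : ℝ) * (log k + log (log k)) - (A + log 2 + 4) * k) (v := L) (by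
    filter_upwards [h, eventually_half_mul_log_le hL h, eventually_ge_atTop 1,
      tendsto_log_natCast.eventually_ge_atTop 1] with k h1 h2 hk hl
    have hk1 : (1 : ℝ) ≤ k := by exact_mod_cast hk
    have h3 := succ_mul_log_sub_le hk1
    have h4 := succ_mul_log_log_sub_le hk1 hl
    have hl0 : 0 < log (k : ℝ) := by linarith
    have h5 := log_le_log (by positivity) h2
    rw [log_div (by positivity) two_ne_zero, log_mul (by positivity) hl0.ne'] at h5
    push_cast
    linarith)
  refine ⟨A + log 2 + 4 + |C|, ?_⟩
  filter_upwards [hC, eventually_ge_atTop 1] with k h1 hk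
  have hk1 : (1 : ℝ) ≤ k := by exact_mod_cast hk
  nlinarith [le_abs_self C, abs_nonneg C]

theorem exists_eventually_le_mul_log_add_log_log_add (hA : 0 ≤ A) (hL : Tendsto L atTop atTop)
    (h : ∀ᶠ k in atTop, L (k + 1) - L k ≤ log (L k) + A) :
    ∃ C : ℝ, ∀ᶠ k : ℕ in atTop, L k ≤ (k : ℝ) * (log k + log (log k)) + C * k := by
  obtain ⟨K, hK⟩ := eventually_atTop.1 (h.and ((hL.eventually_gt_atTop 0).and
    ((tendsto_log_natCast.eventually_ge_atTop 1).and (eventually_ge_atTop 1))))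
  have hC : 2 * A + 4 ≤ 2 * A + 4 + |L K| := by linarith [abs_nonneg (L K)]
  have hCL : L K ≤ 2 * A + 4 + |L K| := by linarith [le_abs_self (L K)]
  generalize 2 * A + 4 + |L K| = C at hC hCL
  refine ⟨C, eventually_atTop.2 ⟨K, fun k hk => ?_⟩⟩
  induction k, hk using Nat.le_induction with
  | base =>
    obtain ⟨-, -, hl, hk⟩ := hK K le_rfl
    have hk1 : (1 : ℝ) ≤ K := by exact_mod_cast hk
    have hll : 0 ≤ log (log (K : ℝ)) := log_nonneg hl
    have : 0 ≤ (K : ℝ) * (log K + log (log K)) := by positivity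
    nlinarith
  | succ k hk ih =>
    obtain ⟨h1, hpos, hl, hk⟩ := hK k hk
    have hk1 : (1 : ℝ) ≤ k := by exact_mod_cast hk
    have hll : 0 ≤ log (log (k : ℝ)) := log_nonneg hl
    have hlog : log (k : ℝ) ≤ log (k + 1 : ℝ) := log_le_log (by linarith) (by linarith)
    have hloglog : log (log (k : ℝ)) ≤ log (log (k + 1 : ℝ)) := log_le_log (by linarith) hlog
    have hlll : log (log (k : ℝ)) ≤ log k := log_le_self (by linarith)
    have h2 : L k ≤ k * (log k * (2 + C)) := ih.trans (by
      rw [mul_comm C, ← mul_add]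
      gcongr
      nlinarith)
    have h3 := log_le_log hpos h2
    rw [log_mul (by positivity) (by nlinarith), log_mul (by linarith) (by linarith)] at h3
    have h4 : log (2 + C) ≤ log 4 + (2 + C - 4) / 4 :=
      log_le_log_add_div (by norm_num) (by linarith)
    have h5 : log (4 : ℝ) ≤ 4 - 1 := log_le_sub_one_of_pos (by norm_num)
    have h6 : ((k : ℝ) + 1) * (log k + log (log k)) ≤
        (k + 1) * (log (k + 1) + log (log (k + 1))) := by gcongr
    push_cast
    linarith

end Recurrence

theorem log_iterPrime_asymptotic (n : ℕ) (hn : (n : ℝ) > Real.exp 4200) :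
    ∃ C : ℝ, C > 0 ∧ ∃ K : ℕ, ∀ k : ℕ, K ≤ k →
      |Real.log (iterPrime n k) - k * (Real.log k + Real.log (Real.log k))| ≤ C * k := by
  obtain ⟨A, hA, hstep⟩ := exists_abs_log_nthPrime_sub_le
  have hL : Tendsto (fun k => log (iterPrime n k : ℝ)) atTop atTop :=
    tendsto_log_natCast.comp (tendsto_iterPrime n)
  have hrec := (tendsto_iterPrime n).eventually hstep
  obtain ⟨C₁, h₁⟩ := exists_eventually_mul_log_add_log_log_sub_le (A := A) hL (by
    filter_upwards [hrec] with k hk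
    simp only [iterPrime]
    linarith [(abs_le.1 hk).1])
  obtain ⟨C₂, h₂⟩ := exists_eventually_le_mul_log_add_log_log_add hA hL (by
    filter_upwards [hrec] with k hk
    simp only [iterPrime]
    linarith [(abs_le.1 hk).2])
  obtain ⟨K, hK⟩ := eventually_atTop.1 (h₁.and h₂)
  refine ⟨|C₁| + |C₂| + 1, by positivity, K, fun k hk => ?_⟩
  obtain ⟨hl, hu⟩ := hK k hk
  have hk0 : (0 : ℝ) ≤ k := k.cast_nonneg
  have e₁ := mul_le_mul_of_nonneg_right (le_abs_self C₁) hk0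
  have e₂ := mul_le_mul_of_nonneg_right (le_abs_self C₂) hk0
  have e₃ := mul_nonneg (abs_nonneg C₁) hk0
  have e₄ := mul_nonneg (abs_nonneg C₂) hk0
  rw [abs_le]
  constructor <;> linarith
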